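/- Let Δ_f be a finite irreducible root system with two root lengths, with squared length ratio k between long and short roots, and Weyl group W_f. If θ is the highest short root, then the lattice generated by W_f(θ^∨) equals Σ_i r_i ℤ α_i^∨, where r_i = 1 if the simple root α_i is short and r_i = k if α_i is long. -/

import Mathlib

open scoped RealInnerProductSpace

/-- The coroot `α^∨ = 2α/(α,α)` of a vector `α` in a real inner product space. -/
noncomputable def coroot {V : Type*} [NormedAddCommGroup V] [InnerProductSpace ℝ V] (α : V) : V :=
  (2 / ⟪α, α⟫) • α

/-- A finite crystallographic root system spanning the space. -/
def IsCrystalRootSystem {V : Type*} [NormedAddCommGroup V] [InnerProductSpace ℝ V]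
    (Δ : Set V) : Prop :=
  Δ.Finite ∧ (0 : V) ∉ Δ ∧ Submodule.span ℝ Δ = ⊤ ∧ (∀ α ∈ Δ, -α ∈ Δ) ∧
  (∀ α ∈ Δ, ∀ β ∈ Δ, ∃ n : ℤ, ⟪coroot α, β⟫ = (n : ℝ)) ∧
  (∀ α ∈ Δ, ∀ β ∈ Δ, β - ⟪coroot α, β⟫ • α ∈ Δ)

/-- Irreducibility: no nontrivial orthogonal decomposition. -/
def IsIrreducibleRS {V : Type*} [NormedAddCommGroup V] [InnerProductSpace ℝ V]
    (Δ : Set V) : Prop :=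
  ∀ Δ₁ Δ₂ : Set V, Δ = Δ₁ ∪ Δ₂ → (∀ α ∈ Δ₁, ∀ β ∈ Δ₂, ⟪α, β⟫ = 0) → Δ₁ = ∅ ∨ Δ₂ = ∅

/-- The set of reflections `s_α` for roots `α ∈ Δ`. -/
def weylReflections {V : Type*} [NormedAddCommGroup V] [InnerProductSpace ℝ V]
    (Δ : Set V) : Set (V ≃ₗ[ℝ] V) :=
  {s | ∃ α ∈ Δ, ∀ x, s x = x - ⟪coroot α, x⟫ • α}

section RootSystemLattice

variable {V : Type*} [NormedAddCommGroup V] [InnerProductSpace ℝ V] {Δ : Set V}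

lemma inner_coroot_left (α x : V) : ⟪coroot α, x⟫ = 2 / ⟪α, α⟫ * ⟪α, x⟫ := by
  rw [coroot, real_inner_smul_left]

lemma inner_coroot_self {α : V} (h : α ≠ 0) : ⟪coroot α, α⟫ = 2 := by
  rw [inner_coroot_left, div_mul_cancel₀]
  exact inner_self_ne_zero.mpr h

lemma exists_weylReflection {α : V} (hα : α ∈ Δ) (h0 : α ≠ 0) :
    ∃ s ∈ weylReflections Δ, ∀ x, s x = x - ⟪coroot α, x⟫ • α := by
  have h2 : (innerₛₗ ℝ (coroot α)) α = 2 := inner_coroot_self h0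
  have hs : ∀ x, Module.reflection h2 x = x - ⟪coroot α, x⟫ • α := fun x => by
    rw [Module.reflection_apply]; rfl
  exact ⟨Module.reflection h2, ⟨α, hα, hs⟩, hs⟩

lemma weylReflection_involutive {s : V ≃ₗ[ℝ] V} {α : V} (h0 : α ≠ 0)
    (hs : ∀ x, s x = x - ⟪coroot α, x⟫ • α) (x : V) : s (s x) = x := by
  rw [hs (s x), hs x, inner_sub_right, real_inner_smul_right, inner_coroot_self h0]
  module

lemma IsCrystalRootSystem.weyl_mem_iff (hΔ : IsCrystalRootSystem Δ) {w : V ≃ₗ[ℝ] V}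
    (hw : w ∈ Subgroup.closure (weylReflections Δ)) : ∀ β, w β ∈ Δ ↔ β ∈ Δ := by
  obtain ⟨-, h0, -, -, -, hrefl⟩ := hΔ
  induction hw using Subgroup.closure_induction with
  | mem s hs =>
    obtain ⟨α, hα, hs⟩ := hs
    have hpres : ∀ β ∈ Δ, s β ∈ Δ := fun β hβ => hs β ▸ hrefl α hα β hβ
    have hα0 : α ≠ 0 := fun h => h0 (h ▸ hα)
    exact fun β => ⟨fun h => weylReflection_involutive hα0 hs β ▸ hpres _ h, hpres β⟩
  | one => exact fun β => Iff.rfl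
  | mul x y _ _ hx hy => exact fun β => (hx (y β)).trans (hy β)
  | inv x _ hx =>
    intro β
    rw [← hx (x⁻¹ β), ← LinearEquiv.mul_apply, mul_inv_cancel]
    rfl

lemma weyl_inner_map (h0 : (0 : V) ∉ Δ) {w : V ≃ₗ[ℝ] V}
    (hw : w ∈ Subgroup.closure (weylReflections Δ)) : ∀ x, ⟪w x, w x⟫ = ⟪x, x⟫ := by
  induction hw using Subgroup.closure_induction with
  | mem s hs =>
    obtain ⟨α, hα, hs⟩ := hs
    have hα0 : ⟪α, α⟫ ≠ 0 := inner_self_ne_zero.mpr fun h => h0 (h ▸ hα)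
    intro x
    simp only [hs, inner_sub_left, inner_sub_right, real_inner_smul_left, real_inner_smul_right,
      inner_coroot_left, real_inner_comm α x]
    field_simp
    ring
  | one => exact fun x => rfl
  | mul x y _ _ hx hy => exact fun β => (hx (y β)).trans (hy β)
  | inv x _ hx =>
    intro β
    rw [← hx (x⁻¹ β), ← LinearEquiv.mul_apply, mul_inv_cancel]
    rfl

/-- In an irreducible root system no root is orthogonal to the whole Weyl orbit of another. -/
lemma IsCrystalRootSystem.exists_weyl_inner_ne_zero (hΔ : IsCrystalRootSystem Δ)
    (hirr : IsIrreducibleRS Δ) {α θ : V} (hα : α ∈ Δ) (hθ : θ ∈ Δ) :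
    ∃ w ∈ Subgroup.closure (weylReflections Δ), ⟪α, w θ⟫ ≠ 0 := by
  obtain ⟨-, h0, -⟩ := hΔ
  have hne : ∀ β ∈ Δ, ⟪β, β⟫ ≠ 0 := fun β hβ => inner_self_ne_zero.mpr fun h => h0 (h ▸ hβ)
  by_contra! hcon
  let P : V → Prop := fun β => ∀ w ∈ Subgroup.closure (weylReflections Δ), ⟪β, w θ⟫ = 0
  have horth : ∀ γ ∈ {β ∈ Δ | P β}, ∀ β ∈ {β ∈ Δ | ¬ P β}, ⟪γ, β⟫ = 0 := by
    rintro γ ⟨-, hγ⟩ β ⟨hβ, hnP⟩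
    obtain ⟨w, hw, hwβ⟩ : ∃ w ∈ Subgroup.closure (weylReflections Δ), ⟪β, w θ⟫ ≠ 0 := by
      simpa [P] using hnP
    obtain ⟨s, hs, hsx⟩ := exists_weylReflection hβ fun h => h0 (h ▸ hβ)
    have h1 := hγ _ (mul_mem (Subgroup.subset_closure hs) hw)
    rw [LinearEquiv.mul_apply, hsx, inner_sub_right, hγ w hw, real_inner_smul_right,
      inner_coroot_left, zero_sub, neg_eq_zero] at h1
    exact (mul_eq_zero.mp h1).resolve_left
      (mul_ne_zero (div_ne_zero two_ne_zero (hne β hβ)) hwβ)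
  rcases hirr {β ∈ Δ | P β} {β ∈ Δ | ¬ P β}
    (by ext β; simp only [Set.mem_union, Set.mem_ofPred_eq]; tauto) horth with h | h
  · exact Set.eq_empty_iff_forall_notMem.mp h α ⟨hα, hcon⟩
  · exact Set.eq_empty_iff_forall_notMem.mp h θ ⟨hθ, fun hP => hne θ hθ (hP 1 (one_mem _))⟩

/-- The Cartan integer `⟨α^∨, μ⟩` of a vector `α` at least as long as `μ` is `0` or `±1`,
unless `α = ±μ`. -/
lemma cartan_integer_cases {α μ : V} {m : ℤ} (hμ : 0 < ⟪μ, μ⟫) (hle : ⟪μ, μ⟫ = ⟪α, α⟫ ∨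
    2 * ⟪μ, μ⟫ ≤ ⟪α, α⟫) (hm : ⟪coroot α, μ⟫ = m) (hm0 : ⟪α, μ⟫ ≠ 0) :
    m = 1 ∨ m = -1 ∨ α = μ ∨ α = -μ := by
  have hα : 0 < ⟪α, α⟫ := by rcases hle with h | h <;> linarith
  have hCS := real_inner_mul_inner_self_le α μ
  have hin : 2 * ⟪α, μ⟫ = m * ⟪α, α⟫ := by
    rw [← hm, inner_coroot_left]; field_simp
  have hmne : m ≠ 0 := by
    rintro rfl
    exact hm0 (by simpa using hin)
  have hsq : (m : ℝ) ^ 2 * ⟪α, α⟫ ≤ 4 * ⟪μ, μ⟫ := by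
    refine le_of_mul_le_mul_right ?_ hα
    calc (m : ℝ) ^ 2 * ⟪α, α⟫ * ⟪α, α⟫ = (2 * ⟪α, μ⟫) * (2 * ⟪α, μ⟫) := by rw [hin]; ring
      _ ≤ 4 * ⟪μ, μ⟫ * ⟪α, α⟫ := by linarith
  rcases hle with h | h
  · have h4 : (m : ℝ) ^ 2 ≤ 4 := le_of_mul_le_mul_right (h ▸ hsq) hα
    have h4' : m ^ 2 ≤ 4 := by exact_mod_cast h4
    have hub : m ≤ 2 := by nlinarith
    have hlb : -2 ≤ m := by nlinarith
    obtain rfl | rfl | rfl | rfl : m = 1 ∨ m = -1 ∨ m = 2 ∨ m = -2 := by omega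
    · simp
    · simp
    · refine Or.inr (Or.inr (Or.inl (sub_eq_zero.mp (inner_self_eq_zero (𝕜 := ℝ).mp ?_))))
      push_cast at hin
      rw [real_inner_sub_sub_self]
      linarith
    · refine Or.inr (Or.inr (Or.inr (eq_neg_of_add_eq_zero_left
        (inner_self_eq_zero (𝕜 := ℝ).mp ?_))))
      push_cast at hin
      rw [real_inner_add_add_self]
      linarith
  · have h2 : (m : ℝ) ^ 2 ≤ 2 := by
      refine le_of_mul_le_mul_right (hsq.trans ?_) hα
      linarith
    have h2' : m ^ 2 ≤ 2 := by exact_mod_cast h2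
    have hub : m ≤ 1 := by nlinarith
    have hlb : -1 ≤ m := by nlinarith
    omega

/-- The lattice generated by the Weyl orbit of a short root contains every root (up to a common
scaling factor `c`). -/
lemma IsCrystalRootSystem.smul_mem_closure_weyl_orbit (hΔ : IsCrystalRootSystem Δ)
    (hirr : IsIrreducibleRS Δ) {θ : V} (hθ : θ ∈ Δ)
    (hlen : ∀ β ∈ Δ, ⟪θ, θ⟫ = ⟪β, β⟫ ∨ 2 * ⟪θ, θ⟫ ≤ ⟪β, β⟫) (c : ℝ) {α : V} (hα : α ∈ Δ) :
    c • α ∈ AddSubgroup.closure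
      {v : V | ∃ w ∈ Subgroup.closure (weylReflections Δ), v = w (c • θ)} := by
  set A := AddSubgroup.closure
      {v : V | ∃ w ∈ Subgroup.closure (weylReflections Δ), v = w (c • θ)}
  have hmem : ∀ w ∈ Subgroup.closure (weylReflections Δ), c • w θ ∈ A := fun w hw =>
    AddSubgroup.subset_closure ⟨w, hw, (map_smul w c θ).symm⟩
  obtain ⟨w, hw, hne⟩ := hΔ.exists_weyl_inner_ne_zero hirr hα hθ
  have hwθ := (hΔ.weyl_mem_iff hw θ).mpr hθ
  have hnorm := weyl_inner_map hΔ.2.1 hw θ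
  have hθpos : 0 < ⟪θ, θ⟫ := real_inner_self_pos.mpr fun h => hΔ.2.1 (h ▸ hθ)
  obtain ⟨m, hm⟩ := hΔ.2.2.2.2.1 α hα _ hwθ
  obtain ⟨s, hs, hsx⟩ := exists_weylReflection hα fun h => hΔ.2.1 (h ▸ hα)
  have h1 := A.sub_mem (hmem w hw) (hmem _ (mul_mem (Subgroup.subset_closure hs) hw))
  rw [LinearEquiv.mul_apply, hsx, hm] at h1
  rcases cartan_integer_cases (hnorm ▸ hθpos) (hnorm ▸ hlen α hα) hm hne with
    rfl | rfl | h | h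
  · convert h1 using 1
    push_cast
    module
  · convert A.neg_mem h1 using 1
    push_cast
    module
  · exact h ▸ hmem w hw
  · rw [h, smul_neg]
    exact A.neg_mem (hmem w hw)

end RootSystemLattice

/-- in a finite irreducible root system with two root lengths (squared length
ratio `k`), if `θ` is the highest short root then the lattice generated by `W_f(θ^∨)` equals
`Σ_i r_i ℤ α_i^∨` with `r_i = 1` for short simple roots and `r_i = k` for long ones. -/
theorem stmt1 {V : Type*} [NormedAddCommGroup V] [InnerProductSpace ℝ V]
    (Δ : Set V) (hΔ : IsCrystalRootSystem Δ) (hirr : IsIrreducibleRS Δ)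
    {n : ℕ} (α : Fin n → V) (hα : ∀ i, α i ∈ Δ) (hind : LinearIndependent ℝ α)
    -- every root is a nonnegative or nonpositive integer combination of the simple roots
    (hsimple : ∀ β ∈ Δ, ∃ c : Fin n → ℤ, ((∀ i, 0 ≤ c i) ∨ (∀ i, c i ≤ 0)) ∧
      β = ∑ i, (c i : ℝ) • α i)
    (sS sL : ℝ) (k : ℕ) (hk : sL = (k : ℝ) * sS) (hkgt : 1 < k)
    -- exactly two root lengths
    (hlen : ∀ β ∈ Δ, ⟪β, β⟫ = sS ∨ ⟪β, β⟫ = sL)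
    (hexS : ∃ β ∈ Δ, ⟪β, β⟫ = sS) (hexL : ∃ β ∈ Δ, ⟪β, β⟫ = sL)
    (θ : V) (hθ : θ ∈ Δ) (hθS : ⟪θ, θ⟫ = sS)
    -- θ is the highest short root
    (hhigh : ∀ β ∈ Δ, ⟪β, β⟫ = sS → ∃ c : Fin n → ℝ, (∀ i, 0 ≤ c i) ∧
      θ - β = ∑ i, c i • α i) :
    AddSubgroup.closure
        {v : V | ∃ w ∈ Subgroup.closure (weylReflections Δ), v = w (coroot θ)} =
      AddSubgroup.closure
        (Set.range fun i =>
          (if ⟪α i, α i⟫ = sS then (1 : ℤ) else (k : ℤ)) • coroot (α i)) := by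
  have hθpos : 0 < ⟪θ, θ⟫ := real_inner_self_pos.mpr fun h => hΔ.2.1 (h ▸ hθ)
  have hSpos : 0 < sS := hθS ▸ hθpos
  have hk2 : (2 : ℝ) ≤ k := by exact_mod_cast hkgt
  have hgen : (fun i => (if ⟪α i, α i⟫ = sS then (1 : ℤ) else (k : ℤ)) • coroot (α i)) =
      fun i => (2 / sS) • α i := by
    funext i
    split_ifs with h
    · rw [one_smul, coroot, h]
    · have hL := (hlen _ (hα i)).resolve_left h
      rw [coroot, hL, hk, ← Int.cast_smul_eq_zsmul ℝ, smul_smul]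
      congr 1
      push_cast
      field_simp
  have hcoroot : coroot θ = (2 / sS) • θ := by rw [coroot, hθS]
  rw [hgen, hcoroot]
  apply le_antisymm
  · rw [AddSubgroup.closure_le]
    rintro _ ⟨w, hw, rfl⟩
    obtain ⟨c, -, hc⟩ := hsimple _ ((hΔ.weyl_mem_iff hw θ).mpr hθ)
    rw [map_smul, hc, Finset.smul_sum]
    refine AddSubgroup.sum_mem _ fun i _ => ?_
    rw [smul_comm, Int.cast_smul_eq_zsmul]
    exact AddSubgroup.zsmul_mem _ (AddSubgroup.subset_closure (Set.mem_range_self i)) _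
  · rw [AddSubgroup.closure_le]
    rintro _ ⟨i, rfl⟩
    refine hΔ.smul_mem_closure_weyl_orbit hirr hθ (fun β hβ => ?_) _ (hα i)
    rw [hθS]
    refine (hlen β hβ).imp Eq.symm fun h => ?_
    rw [h, hk]
    gcongr
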